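/- arXiv:2301.00279 — 4 statements merged into one kernel-verified Lean document; each statement's English description precedes it below -/
import Mathlib

section
/- Let R be a commutative ring and M an R-module. Then M is weak w-projective if and only if M ⊗_R F is a weak w-projective R-module for every projective R-module F. -/
/-!  Background definitions for the `w`-operation theory of Wang–Kim–Qiao.  -/

open CategoryTheory

section WTheory

variable (R : Type) [CommRing R]

/-- `J` is a Glaz–Vasconcelos ideal: it is finitely generated and the natural map
`R → Hom_R(J, R)`, sending `r` to multiplication by `r`, is bijective. -/
def IsGVIdeal (J : Ideal R) : Prop :=
  J.FG ∧ Function.Bijective fun r : R => (r • J.subtype : J →ₗ[R] R)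

/-- `M` is `GV`-torsion: every element is annihilated by some GV-ideal. -/
def IsGVTorsion (M : Type*) [AddCommGroup M] [Module R M] : Prop :=
  ∀ x : M, ∃ J : Ideal R, IsGVIdeal R J ∧ ∀ j ∈ J, j • x = 0

/-- `M` is `GV`-torsion-free: no nonzero element is annihilated by a GV-ideal. -/
def IsGVTorsionFree (M : Type*) [AddCommGroup M] [Module R M] : Prop :=
  ∀ x : M, (∃ J : Ideal R, IsGVIdeal R J ∧ ∀ j ∈ J, j • x = 0) → x = 0

/-- `Ext^n_R(M, N)`, as an `R`-module. -/
noncomputable def extM (M N : Type) [AddCommGroup M] [Module R M]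
    [AddCommGroup N] [Module R N] (n : ℕ) : ModuleCat R :=
  ((Ext R (ModuleCat R) n).obj (Opposite.op (ModuleCat.of R M))).obj (ModuleCat.of R N)

/-- `M` is a `w`-module: it is GV-torsion-free and `Ext^1_R(R/J, M) = 0`
for every GV-ideal `J`. -/
def IsWModule (M : Type) [AddCommGroup M] [Module R M] : Prop :=
  IsGVTorsionFree R M ∧
    ∀ J : Ideal R, IsGVIdeal R J → Subsingleton (extM R (R ⧸ J) M 1)

/-- `(L, ι)` is a `w`-envelope of `M`: `L` is a `w`-module, `ι : M → L` is an injective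
linear map, and its cokernel is GV-torsion. -/
def IsWEnvelope (M L : Type) [AddCommGroup M] [Module R M] [AddCommGroup L]
    [Module R L] (ι : M →ₗ[R] L) : Prop :=
  IsWModule R L ∧ Function.Injective ι ∧ IsGVTorsion R (L ⧸ LinearMap.range ι)

/-- The GV-torsion submodule `tor_GV(M)`.  (The displayed generating set is already closed
under the module operations, since the GV-ideals form a multiplicative system of ideals,
so the span coincides with the displayed set.) -/
def torGV (M : Type) [AddCommGroup M] [Module R M] : Submodule R M :=
  Submodule.span R {x : M | ∃ J : Ideal R, IsGVIdeal R J ∧ ∀ j ∈ J, j • x = 0}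

/-- `M` is `w`-projective: for every GV-torsion-free `w`-module `N` and every
`w`-envelope `(L, ι)` of `M / tor_GV(M)`, the module `Ext^1_R(L, N)` is GV-torsion. -/
def IsWProjective (M : Type) [AddCommGroup M] [Module R M] : Prop :=
  ∀ (N : Type) [AddCommGroup N] [Module R N], IsGVTorsionFree R N → IsWModule R N →
    ∀ (L : Type) [AddCommGroup L] [Module R L] (ι : (M ⧸ torGV R M) →ₗ[R] L),
      IsWEnvelope R (M ⧸ torGV R M) L ι → IsGVTorsion R (extM R L N 1)

/-- `N` belongs to the class `P_w^{†∞}`: it is GV-torsion-free and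
`Ext^k_R(M, N) = 0` for every `w`-projective `M` and every `k ≥ 1`. -/
def MemPwDaggerInfty (N : Type) [AddCommGroup N] [Module R N] : Prop :=
  IsGVTorsionFree R N ∧
    ∀ (M : Type) [AddCommGroup M] [Module R M], IsWProjective R M →
      ∀ k : ℕ, 1 ≤ k → Subsingleton (extM R M N k)

/-- `M` is weak `w`-projective: `Ext^1_R(M, N) = 0` for every `N ∈ P_w^{†∞}`. -/
def IsWeakWProjective (M : Type) [AddCommGroup M] [Module R M] : Prop :=
  ∀ (N : Type) [AddCommGroup N] [Module R N], MemPwDaggerInfty R N →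
    Subsingleton (extM R M N 1)

end WTheory

open TensorProduct

/-- Every linear map out of `M` lifts along every surjection whose kernel is isomorphic
to `N`. -/
def HasExtensionLifting (R : Type) [CommRing R] (M N : Type) [AddCommGroup M] [Module R M]
    [AddCommGroup N] [Module R N] : Prop :=
  ∀ (E X : Type) [AddCommGroup E] [Module R E] [AddCommGroup X] [Module R X]
    (i : N →ₗ[R] E) (p : E →ₗ[R] X), Function.Injective i → Function.Exact i p →
    Function.Surjective p → ∀ h : M →ₗ[R] X, ∃ l : M →ₗ[R] E, p ∘ₗ l = h

namespace HasExtensionLifting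

variable {R : Type} [CommRing R] {M M' N : Type} [AddCommGroup M] [Module R M]
  [AddCommGroup M'] [Module R M'] [AddCommGroup N] [Module R N]

theorem of_retract (H : HasExtensionLifting R M N) (s : M' →ₗ[R] M) (r : M →ₗ[R] M')
    (hrs : r ∘ₗ s = LinearMap.id) : HasExtensionLifting R M' N := by
  intro E X _ _ _ _ i p hi hip hp h
  obtain ⟨l, hl⟩ := H E X i p hi hip hp (h ∘ₗ r)
  exact ⟨l ∘ₗ s, by rw [← LinearMap.comp_assoc, hl, LinearMap.comp_assoc, hrs,
    LinearMap.comp_id]⟩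

theorem finsupp (H : HasExtensionLifting R M N) (ι : Type) :
    HasExtensionLifting R (ι →₀ M) N := by
  intro E X _ _ _ _ i p hi hip hp h
  choose l hl using fun x : ι => H E X i p hi hip hp (h ∘ₗ Finsupp.lsingle x)
  refine ⟨Finsupp.lsum R l, Finsupp.lhom_ext' fun x => ?_⟩
  rw [← hl x]
  ext m
  simp

theorem tensorProduct (H : HasExtensionLifting R M N) {F : Type} [AddCommGroup F] [Module R F]
    [Module.Projective R F] : HasExtensionLifting R (M ⊗[R] F) N := by
  classical
  obtain ⟨s, hs⟩ := Module.projective_def'.1 ‹Module.Projective R F›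
  let e := TensorProduct.finsuppScalarRight R R M F
  refine (H.finsupp F).of_retract (e.toLinearMap ∘ₗ s.lTensor M)
    ((Finsupp.linearCombination R id).lTensor M ∘ₗ e.symm.toLinearMap) ?_
  rw [LinearMap.comp_assoc, ← LinearMap.comp_assoc _ _ e.symm.toLinearMap]
  rw [LinearEquiv.symm_comp, LinearMap.id_comp, ← LinearMap.lTensor_comp, hs,
    LinearMap.lTensor_id]

end HasExtensionLifting

section Ext

variable (R : Type) [CommRing R] (M N : Type) [AddCommGroup M] [Module R M]
  [AddCommGroup N] [Module R N]

theorem subsingleton_extM_one_iff_of_projectiveResolution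
    (P : ProjectiveResolution (ModuleCat.of R M)) :
    Subsingleton (extM R M N 1) ↔
      ∀ f : P.complex.X 1 ⟶ ModuleCat.of R N, P.complex.d 2 1 ≫ f = 0 →
        ∃ g : P.complex.X 0 ⟶ ModuleCat.of R N, P.complex.d 1 0 ≫ g = f := by
  rw [← ModuleCat.isZero_iff_subsingleton]
  unfold extM
  rw [(P.isoExt (R := R) 1 (ModuleCat.of R N)).isZero_iff,
    ← HomologicalComplex.exactAt_iff_isZero_homology,
    HomologicalComplex.exactAt_iff' _ 0 1 2 (by simp) (by simp),
    ShortComplex.moduleCat_exact_iff]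
  rfl

theorem exists_comp_eq_of_hasExtensionLifting {R : Type} [CommRing R] {M N P₀ P₁ : Type}
    [AddCommGroup M] [Module R M] [AddCommGroup N] [Module R N] [AddCommGroup P₀] [Module R P₀]
    [AddCommGroup P₁] [Module R P₁] (H : HasExtensionLifting R M N) {d : P₁ →ₗ[R] P₀}
    {π : P₀ →ₗ[R] M} (hdπ : Function.Exact d π) (hπ : Function.Surjective π) {f : P₁ →ₗ[R] N}
    (hf : LinearMap.ker d ≤ LinearMap.ker f) : ∃ g : P₀ →ₗ[R] N, g ∘ₗ d = f := by
  -- `(N × P₀) ⧸ K` is the pushout of `f` and `d`.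
  let K : Submodule R (N × P₀) := LinearMap.range (f.prod (-d))
  let i : N →ₗ[R] (N × P₀) ⧸ K := K.mkQ ∘ₗ LinearMap.inl R N P₀
  let j : P₀ →ₗ[R] (N × P₀) ⧸ K := K.mkQ ∘ₗ LinearMap.inr R N P₀
  have hK : K ≤ LinearMap.ker (π ∘ₗ LinearMap.snd R N P₀) := by
    rintro _ ⟨x, rfl⟩
    simp [hdπ.apply_apply_eq_zero x]
  let p : (N × P₀) ⧸ K →ₗ[R] M := K.liftQ (π ∘ₗ LinearMap.snd R N P₀) hK
  have hi : Function.Injective i := by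
    rw [injective_iff_map_eq_zero]
    intro n hn
    obtain ⟨x, hx⟩ := (Submodule.Quotient.mk_eq_zero K).1 hn
    obtain ⟨h₁, h₂⟩ := Prod.ext_iff.1 hx
    have hx0 : f x = 0 := hf (by simpa using h₂)
    exact h₁.symm.trans hx0
  have hij (x : P₁) : i (f x) = j (d x) := by
    refine (Submodule.Quotient.eq K).2 ⟨x, ?_⟩
    simp
  have hip : Function.Exact i p := by
    intro y
    constructor
    · obtain ⟨⟨n, a⟩, rfl⟩ := K.mkQ_surjective y
      intro hy
      obtain ⟨x, rfl⟩ := (hdπ a).1 hy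
      refine ⟨n + f x, ?_⟩
      rw [map_add, hij]
      exact (map_add K.mkQ (n, 0) (0, d x)).symm.trans (by simp)
    · rintro ⟨n, rfl⟩
      exact map_zero π
  have hp : Function.Surjective p := fun m => by
    obtain ⟨a, rfl⟩ := hπ m
    exact ⟨j a, rfl⟩
  obtain ⟨l, hl⟩ := H _ M i p hi hip hp LinearMap.id
  have hmem (a : P₀) : j a - l (π a) ∈ LinearMap.range i := by
    refine (hip _).1 ?_
    rw [map_sub, show p (l (π a)) = π a from LinearMap.congr_fun hl (π a)]
    exact sub_self (π a)
  let e := LinearEquiv.ofInjective i hi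
  refine ⟨e.symm.toLinearMap ∘ₗ (j - l ∘ₗ π).codRestrict (LinearMap.range i) hmem, ?_⟩
  ext x
  refine e.symm_apply_eq.2 (Subtype.ext ?_)
  change j (d x) - l (π (d x)) = i (f x)
  rw [hdπ.apply_apply_eq_zero, map_zero, sub_zero, hij]

theorem hasExtensionLifting_of_exists_comp_eq {R : Type} [CommRing R] {M N P₀ P₁ P₂ : Type}
    [AddCommGroup M] [Module R M] [AddCommGroup N] [Module R N] [AddCommGroup P₀] [Module R P₀]
    [AddCommGroup P₁] [Module R P₁] [AddCommGroup P₂] [Module R P₂] [Module.Projective R P₀]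
    {d₂ : P₂ →ₗ[R] P₁} {d₁ : P₁ →ₗ[R] P₀} {π : P₀ →ₗ[R] M} (hd : Function.Exact d₂ d₁)
    (hdπ : Function.Exact d₁ π) (hπ : Function.Surjective π)
    (H : ∀ f : P₁ →ₗ[R] N, f ∘ₗ d₂ = 0 → ∃ g : P₀ →ₗ[R] N, g ∘ₗ d₁ = f) :
    HasExtensionLifting R M N := by
  intro E X _ _ _ _ i p hi hip hp h
  obtain ⟨a, ha⟩ := Module.projective_lifting_property p (h ∘ₗ π) hp
  have hpa (y : P₀) : p (a y) = h (π y) := LinearMap.congr_fun ha y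
  have hmem (x : P₁) : a (d₁ x) ∈ LinearMap.range i :=
    (hip _).1 (by rw [hpa, hdπ.apply_apply_eq_zero, map_zero])
  let e := LinearEquiv.ofInjective i hi
  let f : P₁ →ₗ[R] N := e.symm.toLinearMap ∘ₗ (a ∘ₗ d₁).codRestrict (LinearMap.range i) hmem
  have hf (x : P₁) : i (f x) = a (d₁ x) := congrArg Subtype.val (e.apply_symm_apply ⟨_, hmem x⟩)
  obtain ⟨g, hg⟩ := H f (by
    ext x
    apply hi
    change i (f (d₂ x)) = i 0
    rw [hf, hd.apply_apply_eq_zero, map_zero, map_zero])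
  let b : P₀ →ₗ[R] E := a - i ∘ₗ g
  have hb : LinearMap.ker π ≤ LinearMap.ker b := by
    intro y hy
    obtain ⟨x, rfl⟩ := (hdπ y).1 hy
    change a (d₁ x) - i (g (d₁ x)) = 0
    rw [show g (d₁ x) = f x from LinearMap.congr_fun hg x, hf, sub_self]
  let q := π.quotKerEquivOfSurjective hπ
  refine ⟨(LinearMap.ker π).liftQ b hb ∘ₗ q.symm.toLinearMap, ?_⟩
  ext m
  obtain ⟨y, rfl⟩ := hπ m
  have hq : q.symm (π y) = (LinearMap.ker π).mkQ y := q.symm_apply_eq.2 rfl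
  change p ((LinearMap.ker π).liftQ b hb (q.symm (π y))) = h (π y)
  rw [hq]
  change p (a y - i (g y)) = h (π y)
  rw [map_sub, hip.apply_apply_eq_zero, sub_zero, hpa]

/-- `Ext¹_R(M, N)` vanishes iff maps out of `M` lift along surjections with kernel `N`. -/
theorem subsingleton_extM_one_iff :
    Subsingleton (extM R M N 1) ↔ HasExtensionLifting R M N := by
  let P := projectiveResolution (ModuleCat.of R M)
  have hsurj : Function.Surjective (P.π.f 0).hom :=
    (ModuleCat.epi_iff_surjective _).1 inferInstance
  have hex₀ : Function.Exact (P.complex.d 1 0).hom (P.π.f 0).hom :=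
    (ShortComplex.ShortExact.moduleCat_exact_iff_function_exact _).1 P.exact₀
  have hex₁ : Function.Exact (P.complex.d 2 1).hom (P.complex.d 1 0).hom :=
    (ShortComplex.ShortExact.moduleCat_exact_iff_function_exact _).1 (P.exact_succ 0)
  have : Module.Projective R (P.complex.X 0) :=
    (IsProjective.iff_projective _).2 (P.projective 0)
  rw [subsingleton_extM_one_iff_of_projectiveResolution R M N P]
  refine ⟨fun H => ?_, fun H f hf => ?_⟩
  · exact hasExtensionLifting_of_exists_comp_eq hex₁ hex₀ hsurj fun f hf => by
      obtain ⟨g, hg⟩ := H (ModuleCat.ofHom f) (ModuleCat.hom_ext hf)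
      exact ⟨g.hom, congrArg ModuleCat.Hom.hom hg⟩
  · obtain ⟨g, hg⟩ := exists_comp_eq_of_hasExtensionLifting H hex₀ hsurj (f := f.hom) (by
      intro x hx
      obtain ⟨y, rfl⟩ := (hex₁ x).1 hx
      exact LinearMap.congr_fun (congrArg ModuleCat.Hom.hom hf) y)
    exact ⟨ModuleCat.ofHom g, ModuleCat.hom_ext hg⟩

end Ext

/-- `M` is weak `w`-projective iff `M ⊗_R F` is weak `w`-projective for
every projective `R`-module `F`. -/
theorem weakWProjective_iff_tensor_projective (R : Type) [CommRing R]
    (M : Type) [AddCommGroup M] [Module R M] :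
    IsWeakWProjective R M ↔
      ∀ (F : Type) [AddCommGroup F] [Module R F], Module.Projective R F →
        IsWeakWProjective R (TensorProduct R M F) := by
  constructor
  · intro h F _ _ _ N _ _ hN
    rw [subsingleton_extM_one_iff]
    exact HasExtensionLifting.tensorProduct ((subsingleton_extM_one_iff R M N).1 (h N hN))
  · intro h N _ _ hN
    rw [subsingleton_extM_one_iff]
    exact ((subsingleton_extM_one_iff R _ N).1 (h R inferInstance N hN)).of_retract
      (TensorProduct.rid R M).symm.toLinearMap (TensorProduct.rid R M).toLinearMap
      (by ext; simp)
end

section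
/- Let R be a commutative ring and M an R-module. Then M is weak w-projective if and only if Hom_R(F, M) is a weak w-projective R-module for every finitely generated projective R-module F. -/
/-!  Background definitions for the `w`-operation theory of Wang–Kim–Qiao.  -/

open CategoryTheory

instance CategoryTheory.Functor.leftDerived_additive {C D : Type*} [Category* C] [Category* D]
    [Abelian C] [Abelian D] [HasProjectiveResolutions C] (F : C ⥤ D) [F.Additive] (n : ℕ) :
    (F.leftDerived n).Additive where
  map_add {X Y f g} := by
    let P := projectiveResolution X
    let Q := projectiveResolution Y
    rw [F.leftDerived_map_eq n f (ProjectiveResolution.lift f P Q)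
        (ProjectiveResolution.lift_commutes f P Q),
      F.leftDerived_map_eq n g (ProjectiveResolution.lift g P Q)
        (ProjectiveResolution.lift_commutes g P Q),
      F.leftDerived_map_eq n (f + g)
        (ProjectiveResolution.lift f P Q + ProjectiveResolution.lift g P Q)
        (by simp [Preadditive.add_comp, Preadditive.comp_add, Functor.map_add]),
      Functor.map_add, Preadditive.add_comp, Preadditive.comp_add]

/-- The functor `Ext^n_R(-, N)`. -/
noncomputable def extContravariant (R : Type) [CommRing R] (N : ModuleCat.{0} R) (n : ℕ) :
    (ModuleCat.{0} R)ᵒᵖ ⥤ ModuleCat R :=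
  (((linearYoneda R (ModuleCat.{0} R)).obj N).rightOp.leftDerived n).leftOp

instance (R : Type) [CommRing R] (N : ModuleCat.{0} R) (n : ℕ) :
    (extContravariant R N n).Additive :=
  inferInstanceAs (Functor.Additive (Functor.leftOp _))

/-- If the identity of `P` is a finite sum of endomorphisms factoring through `M`, then
`Ext^n_R(P, N)` vanishes whenever `Ext^n_R(M, N)` does. -/
theorem subsingleton_extM_of_sum_comp_eq_id {R : Type} [CommRing R] {P M N : Type}
    [AddCommGroup P] [Module R P] [AddCommGroup M] [Module R M] [AddCommGroup N] [Module R N]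
    {n : ℕ} (hM : Subsingleton (extM R M N n)) {ι : Type*} [Fintype ι]
    (a : ι → P →ₗ[R] M) (b : ι → M →ₗ[R] P) (hab : ∑ i, b i ∘ₗ a i = .id) :
    Subsingleton (extM R P N n) := by
  let E := extContravariant R (ModuleCat.of R N) n
  have hzero : Limits.IsZero (E.obj (Opposite.op (ModuleCat.of R M))) :=
    @ModuleCat.isZero_of_subsingleton R _ (extM R M N n) hM
  have hid : 𝟙 (Opposite.op (ModuleCat.of R P)) =
      ∑ i, (ModuleCat.ofHom (b i)).op ≫ (ModuleCat.ofHom (a i)).op := by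
    apply Quiver.Hom.unop_inj
    rw [unop_sum]
    ext x
    simpa using (LinearMap.congr_fun hab x).symm
  refine ModuleCat.subsingleton_of_isZero (M := E.obj (Opposite.op (ModuleCat.of R P))) ?_
  rw [Limits.IsZero.iff_id_eq_zero, ← E.map_id, hid, E.map_sum]
  exact Finset.sum_eq_zero fun i _ => by
    rw [E.map_comp, hzero.eq_of_tgt (E.map _) 0, Limits.zero_comp]

/-- A finitely generated projective module has a finite dual basis. -/
theorem Module.exists_fin_dualBasis (R F : Type*) [CommRing R] [AddCommGroup F] [Module R F]
    [Module.Finite R F] [Module.Projective R F] :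
    ∃ (n : ℕ) (e : Fin n → F) (f : Fin n → F →ₗ[R] R), ∀ x, ∑ i, f i x • e i = x := by
  obtain ⟨n, p, s, -, -, hps⟩ := Module.Finite.exists_comp_eq_id_of_projective R F
  refine ⟨n, fun i => p (Pi.single i 1), fun i => LinearMap.proj i ∘ₗ s, fun x => ?_⟩
  conv_rhs => rw [← LinearMap.id_apply (R := R) x, ← hps]
  simp [← map_smul, ← map_sum, ← Pi.single_smul, Finset.univ_sum_single]

/-- `M` is weak `w`-projective iff `Hom_R(F, M)` is weak `w`-projective for
every finitely generated projective `R`-module `F`. -/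
theorem weakWProjective_iff_hom_finite_projective (R : Type) [CommRing R]
    (M : Type) [AddCommGroup M] [Module R M] :
    IsWeakWProjective R M ↔
      ∀ (F : Type) [AddCommGroup F] [Module R F], Module.Finite R F →
        Module.Projective R F → IsWeakWProjective R (F →ₗ[R] M) := by
  refine ⟨fun hM F _ _ _ _ N _ _ hN => ?_, fun h N _ _ hN => ?_⟩
  · obtain ⟨n, e, f, hef⟩ := Module.exists_fin_dualBasis R F
    refine subsingleton_extM_of_sum_comp_eq_id (hM N hN)
      (fun i => LinearMap.applyₗ (e i)) (fun i => LinearMap.smulRightₗ (f i)) ?_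
    ext g x
    conv_rhs => rw [LinearMap.id_apply, ← hef x, map_sum]
    simp [LinearMap.sum_apply]
  · refine subsingleton_extM_of_sum_comp_eq_id (h R inferInstance inferInstance N hN) (ι := Unit)
      (fun _ => (LinearMap.ringLmapEquivSelf R R M).symm.toLinearMap)
      (fun _ => (LinearMap.ringLmapEquivSelf R R M).toLinearMap) ?_
    ext x
    simp
end

section
/- Let R be a commutative ring. Every weak w-projective R-module of finite type is of finitely presented type. -/
/-!  Background definitions for the `w`-operation theory of Wang–Kim–Qiao.  -/

open CategoryTheory

section WExactness

variable (R : Type) [CommRing R]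

/-- `I` is a `w`-ideal of `R`. -/
def IsWIdeal (I : Ideal R) : Prop :=
  ∀ x : R, (∃ J : Ideal R, IsGVIdeal R J ∧ ∀ j ∈ J, j * x ∈ I) → x ∈ I

/-- `P` is a maximal `w`-ideal: it is maximal among proper `w`-ideals of `R`.
(Every maximal `w`-ideal is a prime ideal.) -/
def IsMaxWIdeal (P : Ideal R) : Prop :=
  IsWIdeal R P ∧ P ≠ ⊤ ∧ ∀ I : Ideal R, IsWIdeal R I → I ≠ ⊤ → P ≤ I → I = P

/-- The localization of a linear map at a submonoid. -/
noncomputable def locMap (S : Submonoid R) {A B : Type} [AddCommGroup A] [Module R A]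
    [AddCommGroup B] [Module R B] (f : A →ₗ[R] B) :
    LocalizedModule S A →ₗ[R] LocalizedModule S B :=
  IsLocalizedModule.map S (LocalizedModule.mkLinearMap S A) (LocalizedModule.mkLinearMap S B) f

/-- `f` is a `w`-monomorphism: its localization at every maximal `w`-ideal is injective. -/
def IsWMono {A B : Type} [AddCommGroup A] [Module R A] [AddCommGroup B] [Module R B]
    (f : A →ₗ[R] B) : Prop :=
  ∀ (P : Ideal R), IsMaxWIdeal R P → ∀ [P.IsPrime],
    Function.Injective (locMap R P.primeCompl f)

/-- `f` is a `w`-epimorphism: its localization at every maximal `w`-ideal is surjective. -/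
def IsWEpi {A B : Type} [AddCommGroup A] [Module R A] [AddCommGroup B] [Module R B]
    (f : A →ₗ[R] B) : Prop :=
  ∀ (P : Ideal R), IsMaxWIdeal R P → ∀ [P.IsPrime],
    Function.Surjective (locMap R P.primeCompl f)

/-- `0 → A → B → C → 0` is a `w`-exact sequence: its localization at every maximal
`w`-ideal is a short exact sequence. -/
def IsWShortExact {A B C : Type} [AddCommGroup A] [Module R A] [AddCommGroup B] [Module R B]
    [AddCommGroup C] [Module R C] (f : A →ₗ[R] B) (g : B →ₗ[R] C) : Prop :=
  ∀ (P : Ideal R), IsMaxWIdeal R P → ∀ [P.IsPrime],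
    Function.Injective (locMap R P.primeCompl f) ∧
    Function.Exact (locMap R P.primeCompl f) (locMap R P.primeCompl g) ∧
    Function.Surjective (locMap R P.primeCompl g)

/-- `M` is of finite type: there is a `w`-epimorphism from a finitely generated free module. -/
def IsFiniteType (M : Type) [AddCommGroup M] [Module R M] : Prop :=
  ∃ (n : ℕ) (g : (Fin n → R) →ₗ[R] M), IsWEpi R g

/-- `M` is of finitely presented type: there is a `w`-exact sequence
`F₁ → F₀ → M → 0` with `F₁`, `F₀` finitely generated free. -/
def IsFinitelyPresentedType (M : Type) [AddCommGroup M] [Module R M] : Prop :=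
  ∃ (m n : ℕ) (f : (Fin m → R) →ₗ[R] (Fin n → R)) (g : (Fin n → R) →ₗ[R] M),
    IsWEpi R g ∧ ∀ (P : Ideal R), IsMaxWIdeal R P → ∀ [P.IsPrime],
      Function.Exact (locMap R P.primeCompl f) (locMap R P.primeCompl g)

/-- `M` is `w`-flat: tensoring with `M` preserves `w`-monomorphisms. -/
def IsWFlat (M : Type) [AddCommGroup M] [Module R M] : Prop :=
  ∀ (A B : Type) [AddCommGroup A] [Module R A] [AddCommGroup B] [Module R B]
    (f : A →ₗ[R] B), IsWMono R f → IsWMono R (LinearMap.lTensor M f)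

end WExactness

section ExtComparison

open Abelian

variable {R : Type} [CommRing R]

/-- Classes in the homology of a short complex of modules, and which of their multiples vanish. -/
lemma exists_cocycle_smul_eq_zero_iff (S : ShortComplex (ModuleCat R)) (x : S.homology) :
    ∃ z : S.X₂, S.g z = 0 ∧ ∀ r : R, r • x = 0 ↔ ∃ y : S.X₁, S.f y = r • z := by
  let e : S.homology ≃ₗ[R] (LinearMap.ker S.g.hom ⧸ LinearMap.range S.moduleCatToCycles) :=
    S.moduleCatHomologyIso.toLinearEquiv
  obtain ⟨⟨z, hz⟩, hzx⟩ := Submodule.Quotient.mk_surjective _ (e x)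
  refine ⟨z, hz, fun r => ?_⟩
  rw [← e.map_eq_zero_iff, map_smul, ← hzx, ← Submodule.Quotient.mk_smul,
    Submodule.Quotient.mk_eq_zero]
  exact ⟨fun ⟨y, hy⟩ => ⟨y, congrArg Subtype.val hy⟩, fun ⟨y, hy⟩ => ⟨y, Subtype.ext hy⟩⟩

lemma exists_class_smul_eq_zero_iff (S : ShortComplex (ModuleCat R)) (z : S.X₂) (hz : S.g z = 0) :
    ∃ x : S.homology, ∀ r : R, r • x = 0 ↔ ∃ y : S.X₁, S.f y = r • z := by
  let e : S.homology ≃ₗ[R] (LinearMap.ker S.g.hom ⧸ LinearMap.range S.moduleCatToCycles) :=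
    S.moduleCatHomologyIso.toLinearEquiv
  let z' : LinearMap.ker S.g.hom := ⟨z, hz⟩
  refine ⟨e.symm (Submodule.Quotient.mk z'), fun r => ?_⟩
  rw [← map_smul, e.symm.map_eq_zero_iff, ← Submodule.Quotient.mk_smul,
    Submodule.Quotient.mk_eq_zero]
  exact ⟨fun ⟨y, hy⟩ => ⟨y, congrArg Subtype.val hy⟩, fun ⟨y, hy⟩ => ⟨y, Subtype.ext hy⟩⟩

variable (M N : Type) [AddCommGroup M] [Module R M] [AddCommGroup N] [Module R N]

/-- `Ext` groups in the sense of derived categories, for unbundled modules. -/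
abbrev ExtD (n : ℕ) : Type := Abelian.Ext (ModuleCat.of R M) (ModuleCat.of R N) n

variable {M} in
lemma smul_extMk_eq_zero_iff (P : ProjectiveResolution (ModuleCat.of R M)) {n : ℕ}
    (z : P.complex.X (n + 1) ⟶ ModuleCat.of R N) (hz : P.complex.d (n + 2) (n + 1) ≫ z = 0)
    (r : R) : r • P.extMk z (n + 2) rfl hz = 0 ↔
      ∃ y : P.complex.X n ⟶ ModuleCat.of R N, P.complex.d (n + 1) n ≫ y = r • z := by
  rw [Ext.smul_eq_comp_mk₀, P.extMk_comp_mk₀, P.extMk_eq_zero_iff _ _ _ _ n rfl]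
  simp

lemma exists_extD_smul_eq_zero_iff (n : ℕ) (x : extM R M N (n + 1)) :
    ∃ y : ExtD (R := R) M N (n + 1), ∀ r : R, r • x = 0 ↔ r • y = 0 := by
  let P := projectiveResolution (ModuleCat.of R M)
  let C := P.complex.linearYonedaObj R (ModuleCat.of R N)
  let e : extM R M N (n + 1) ≃ₗ[R] (C.sc' n (n + 1) (n + 2)).homology :=
    (P.isoExt (n + 1) (ModuleCat.of R N) ≪≫
      C.homologyIsoSc' n (n + 1) (n + 2) (by simp) (by simp)).toLinearEquiv
  obtain ⟨z, hz, h⟩ := exists_cocycle_smul_eq_zero_iff _ (e x)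
  refine ⟨P.extMk z (n + 2) rfl hz, fun r => Iff.trans ?_ (smul_extMk_eq_zero_iff N P z hz r).symm⟩
  rw [← e.map_eq_zero_iff, map_smul]
  exact h r

lemma exists_extM_smul_eq_zero_iff (n : ℕ) (y : ExtD (R := R) M N (n + 1)) :
    ∃ x : extM R M N (n + 1), ∀ r : R, r • x = 0 ↔ r • y = 0 := by
  let P := projectiveResolution (ModuleCat.of R M)
  let C := P.complex.linearYonedaObj R (ModuleCat.of R N)
  let e : extM R M N (n + 1) ≃ₗ[R] (C.sc' n (n + 1) (n + 2)).homology :=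
    (P.isoExt (n + 1) (ModuleCat.of R N) ≪≫
      C.homologyIsoSc' n (n + 1) (n + 2) (by simp) (by simp)).toLinearEquiv
  obtain ⟨z, hz, rfl⟩ := P.extMk_surjective y (n + 2) rfl
  obtain ⟨x, h⟩ := exists_class_smul_eq_zero_iff (C.sc' n (n + 1) (n + 2)) z hz
  refine ⟨e.symm x, fun r => ?_⟩
  rw [smul_extMk_eq_zero_iff, ← map_smul, e.symm.map_eq_zero_iff, h]
  rfl

lemma subsingleton_extM_iff (n : ℕ) :
    Subsingleton (extM R M N (n + 1)) ↔ Subsingleton (ExtD (R := R) M N (n + 1)) := by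
  constructor
  · refine fun h => subsingleton_of_forall_eq 0 fun y => ?_
    obtain ⟨x, hx⟩ := exists_extM_smul_eq_zero_iff M N n y
    simpa using (hx 1).1 (Subsingleton.elim _ _)
  · refine fun h => subsingleton_of_forall_eq 0 fun x => ?_
    obtain ⟨y, hy⟩ := exists_extD_smul_eq_zero_iff M N n x
    simpa using (hy 1).2 (Subsingleton.elim _ _)

lemma isGVTorsion_extD (n : ℕ) (h : IsGVTorsion R (extM R M N (n + 1))) :
    IsGVTorsion R (ExtD (R := R) M N (n + 1)) := by
  intro y
  obtain ⟨x, hx⟩ := exists_extM_smul_eq_zero_iff M N n y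
  obtain ⟨J, hJ, hJx⟩ := h x
  exact ⟨J, hJ, fun j hj => (hx j).1 (hJx j hj)⟩

end ExtComparison

section ExtSequences

open Abelian

variable {R : Type} [CommRing R] {A B C : Type} [AddCommGroup A] [Module R A]
  [AddCommGroup B] [Module R B] [AddCommGroup C] [Module R C]
  {f : A →ₗ[R] B} {g : B →ₗ[R] C}

/-- The short complex of modules attached to an exact pair of linear maps. -/
abbrev shortComplexOfExact (hfg : Function.Exact f g) : ShortComplex (ModuleCat R) :=
  ShortComplex.mk (ModuleCat.ofHom f) (ModuleCat.ofHom g)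
    (ModuleCat.hom_ext hfg.linearMap_comp_eq_zero)

lemma shortExact_shortComplexOfExact (hf : Function.Injective f) (hfg : Function.Exact f g)
    (hg : Function.Surjective g) : (shortComplexOfExact hfg).ShortExact where
  exact := (ShortComplex.ShortExact.moduleCat_exact_iff_function_exact _).2 hfg
  mono_f := (ModuleCat.mono_iff_injective _).2 hf
  epi_g := (ModuleCat.epi_iff_surjective _).2 hg

variable {N : Type} [AddCommGroup N] [Module R N]

lemma subsingleton_extD_right (hf : Function.Injective f) (hfg : Function.Exact f g)
    (hg : Function.Surjective g) {n : ℕ} (hA : Subsingleton (ExtD (R := R) A N n))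
    (hB : Subsingleton (ExtD (R := R) B N (n + 1))) :
    Subsingleton (ExtD (R := R) C N (n + 1)) := by
  refine subsingleton_of_forall_eq 0 fun x => ?_
  obtain ⟨y, rfl⟩ := Ext.contravariant_sequence_exact₃
    (shortExact_shortComplexOfExact hf hfg hg) _ x (hB.elim _ _) (add_comm 1 n)
  rw [hA.elim y 0, Ext.comp_zero]

lemma subsingleton_extD_left (hf : Function.Injective f) (hfg : Function.Exact f g)
    (hg : Function.Surjective g) {n : ℕ} (hB : Subsingleton (ExtD (R := R) B N n))
    (hC : Subsingleton (ExtD (R := R) C N (n + 1))) :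
    Subsingleton (ExtD (R := R) A N n) := by
  refine subsingleton_of_forall_eq 0 fun x => ?_
  obtain ⟨y, rfl⟩ := Ext.contravariant_sequence_exact₁
    (shortExact_shortComplexOfExact hf hfg hg) _ x (add_comm 1 n) (hC.elim _ _)
  rw [hB.elim y 0, Ext.comp_zero]

lemma subsingleton_extD_middle (hf : Function.Injective f) (hfg : Function.Exact f g)
    (hg : Function.Surjective g) {n : ℕ} (hA : Subsingleton (ExtD (R := R) A N n))
    (hC : Subsingleton (ExtD (R := R) C N n)) :
    Subsingleton (ExtD (R := R) B N n) := by
  refine subsingleton_of_forall_eq 0 fun x => ?_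
  obtain ⟨y, rfl⟩ := Ext.contravariant_sequence_exact₂
    (shortExact_shortComplexOfExact hf hfg hg) _ x (hA.elim _ _)
  rw [hC.elim y 0, Ext.comp_zero]

lemma subsingleton_extD_zero (h : Subsingleton (A →ₗ[R] N)) :
    Subsingleton (ExtD (R := R) A N 0) :=
  (Ext.homEquiv₀.trans (ModuleCat.homEquiv (R := R))).subsingleton

lemma subsingleton_extD_of_projective [Module.Projective R A] (n : ℕ) :
    Subsingleton (ExtD (R := R) A N (n + 1)) :=
  have : Projective (ModuleCat.of R A) := (IsProjective.iff_projective A).1 inferInstance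
  Ext.subsingleton_of_projective _ _ n

lemma exists_extend_of_subsingleton_extD (hf : Function.Injective f) (hfg : Function.Exact f g)
    (hg : Function.Surjective g) (hC : Subsingleton (ExtD (R := R) C N 1)) (u : A →ₗ[R] N) :
    ∃ v : B →ₗ[R] N, v ∘ₗ f = u := by
  obtain ⟨y, hy⟩ := Ext.contravariant_sequence_exact₁
    (shortExact_shortComplexOfExact hf hfg hg) _ (Ext.mk₀ (ModuleCat.ofHom u))
    (add_zero 1) (hC.elim _ _)
  obtain ⟨v, rfl⟩ := (Ext.mk₀_bijective _ _).2 y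
  rw [Ext.mk₀_comp_mk₀] at hy
  exact ⟨v.hom, congrArg ModuleCat.Hom.hom ((Ext.mk₀_bijective _ _).1 hy)⟩

lemma subsingleton_extD_one [Module.Projective R B] (hf : Function.Injective f)
    (hfg : Function.Exact f g) (hg : Function.Surjective g)
    (h : ∀ u : A →ₗ[R] N, ∃ v : B →ₗ[R] N, v ∘ₗ f = u) :
    Subsingleton (ExtD (R := R) C N 1) := by
  have hS := shortExact_shortComplexOfExact hf hfg hg
  refine subsingleton_of_forall_eq 0 fun x => ?_
  have hB : Subsingleton (ExtD (R := R) B N 1) := subsingleton_extD_of_projective 0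
  obtain ⟨y, rfl⟩ := Ext.contravariant_sequence_exact₃ hS _ x (hB.elim _ _) (add_zero 1)
  obtain ⟨u, rfl⟩ := (Ext.mk₀_bijective _ _).2 y
  obtain ⟨v, hv⟩ := h u.hom
  have hu : u = (shortComplexOfExact hfg).f ≫ ModuleCat.ofHom v := ModuleCat.hom_ext hv.symm
  rw [hu, ← Ext.mk₀_comp_mk₀, hS.extClass_comp_assoc]

/-- If `r` kills the class of an extension of `C`, then multiplication by `r` on `C` lifts to the
middle term. -/
lemma exists_smul_lift_of_smul_extClass_eq_zero (hf : Function.Injective f)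
    (hfg : Function.Exact f g) (hg : Function.Surjective g) (r : R)
    (h : r • (shortExact_shortComplexOfExact hf hfg hg).extClass = 0) :
    ∃ p : C →ₗ[R] B, ∀ x, g (p x) = r • x := by
  have hS := shortExact_shortComplexOfExact hf hfg hg
  obtain ⟨y, hy⟩ := Ext.covariant_sequence_exact₃ (shortComplexOfExact hfg).X₃ hS
    (Ext.mk₀ (r • 𝟙 (shortComplexOfExact hfg).X₃)) (zero_add 1)
    (by rw [Ext.mk₀_smul, Ext.smul_comp, Ext.mk₀_id_comp]; exact h)
  obtain ⟨v, rfl⟩ := (Ext.mk₀_bijective _ _).2 y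
  rw [Ext.mk₀_comp_mk₀] at hy
  have := congrArg ModuleCat.Hom.hom ((Ext.mk₀_bijective _ _).1 hy)
  exact ⟨v.hom, fun x => LinearMap.congr_fun this x⟩

end ExtSequences

section GVClosure

variable {R : Type} [CommRing R]

lemma isGVIdeal_iff {J : Ideal R} : IsGVIdeal R J ↔ J.FG ∧
    (∀ r : R, (∀ j ∈ J, r * j = 0) → r = 0) ∧
      ∀ f : J →ₗ[R] R, ∃ r : R, ∀ j : J, f j = r * j := by
  refine and_congr_right fun _ => and_congr ⟨fun h r hr => h ?_, fun h r s hrs => ?_⟩ ?_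
  · ext j
    simpa using hr j j.2
  · refine sub_eq_zero.1 (h _ fun j hj => ?_)
    have := LinearMap.congr_fun hrs ⟨j, hj⟩
    simpa [sub_mul, sub_eq_zero] using this
  · refine forall_congr' fun f => exists_congr fun r => ?_
    rw [eq_comm, LinearMap.ext_iff]
    rfl

lemma isGVIdeal_top : IsGVIdeal R (⊤ : Ideal R) := by
  refine isGVIdeal_iff.2 ⟨⟨{1}, by simp⟩, fun r hr => by simpa using hr 1 trivial, fun f => ?_⟩
  refine ⟨f ⟨1, trivial⟩, fun j => ?_⟩
  rw [mul_comm, ← smul_eq_mul, ← map_smul]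
  congr 1
  ext
  simp

lemma IsGVIdeal.mul {I J : Ideal R} (hI : IsGVIdeal R I) (hJ : IsGVIdeal R J) :
    IsGVIdeal R (I * J) := by
  rw [isGVIdeal_iff] at *
  obtain ⟨hI, hI1, hI2⟩ := hI
  obtain ⟨hJ, hJ1, hJ2⟩ := hJ
  refine ⟨Submodule.FG.mul hI hJ, fun r hr => hJ1 r fun b hb => hI1 _ fun a ha => ?_, fun f => ?_⟩
  · rw [mul_assoc, mul_comm b]
    exact hr _ (Ideal.mul_mem_mul ha hb)
  · have key (b : J) : ∃ r : R, ∀ a : I, f ⟨a * b, Ideal.mul_mem_mul a.2 b.2⟩ = r * a :=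
      hI2 { toFun := fun a => f ⟨a * b, Ideal.mul_mem_mul a.2 b.2⟩
            map_add' := fun a a' => by
              rw [← map_add]
              congr 1
              ext
              simp [add_mul]
            map_smul' := fun r a => by
              rw [← map_smul]
              congr 1
              ext
              simp [mul_assoc] }
    choose r hr using key
    obtain ⟨s, hs⟩ := hJ2
      { toFun := r
        map_add' := fun b b' => by
          refine sub_eq_zero.1 (hI1 _ fun a ha => ?_)
          have h : f ⟨a * ↑(b + b'), Ideal.mul_mem_mul ha (b + b').2⟩ =
              f ⟨a * b, Ideal.mul_mem_mul ha b.2⟩ + f ⟨a * b', Ideal.mul_mem_mul ha b'.2⟩ := by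
            rw [← map_add]
            congr 1
            ext
            simp [mul_add]
          rw [hr _ ⟨a, ha⟩, hr _ ⟨a, ha⟩, hr _ ⟨a, ha⟩] at h
          linear_combination h
        map_smul' := fun c b => by
          refine sub_eq_zero.1 (hI1 _ fun a ha => ?_)
          have h : f ⟨a * ↑(c • b), Ideal.mul_mem_mul ha (c • b).2⟩ =
              c • f ⟨a * b, Ideal.mul_mem_mul ha b.2⟩ := by
            rw [← map_smul]
            congr 1
            ext
            simp [mul_left_comm]
          rw [hr _ ⟨a, ha⟩, hr _ ⟨a, ha⟩] at h
          simp only [smul_eq_mul, RingHom.id_apply] at h ⊢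
          linear_combination h }
    refine ⟨s, fun j => ?_⟩
    obtain ⟨j, hj⟩ := j
    induction hj using Submodule.mul_induction_on' with
    | mem_mul_mem a ha b hb =>
      have h1 := hr ⟨b, hb⟩ ⟨a, ha⟩
      have h2 := hs ⟨b, hb⟩
      simp only [LinearMap.coe_mk, AddHom.coe_mk] at h1 h2
      rw [h1, h2]
      ring
    | add x hx y hy ihx ihy =>
      have : (⟨x + y, add_mem hx hy⟩ : ↥(I * J)) = ⟨x, hx⟩ + ⟨y, hy⟩ := rfl
      rw [this, map_add, ihx, ihy]
      simp [mul_add]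

variable {M : Type} [AddCommGroup M] [Module R M]

/-- The elements of `M` that some GV-ideal multiplies into `S`. -/
def wClosure (S : Submodule R M) : Submodule R M where
  carrier := {x | ∃ J : Ideal R, IsGVIdeal R J ∧ ∀ j ∈ J, j • x ∈ S}
  zero_mem' := ⟨⊤, isGVIdeal_top, by simp⟩
  add_mem' := by
    rintro x y ⟨I, hI, hx⟩ ⟨J, hJ, hy⟩
    refine ⟨I * J, hI.mul hJ, fun j hj => ?_⟩
    rw [smul_add]
    exact S.add_mem (hx j (Ideal.mul_le_left hj)) (hy j (Ideal.mul_le_right hj))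
  smul_mem' := by
    rintro r x ⟨J, hJ, hx⟩
    refine ⟨J, hJ, fun j hj => ?_⟩
    rw [smul_comm]
    exact S.smul_mem r (hx j hj)

lemma le_wClosure (S : Submodule R M) : S ≤ wClosure S :=
  fun _ hx => ⟨⊤, isGVIdeal_top, fun j _ => S.smul_mem j hx⟩

/-- A single GV-ideal multiplies a finitely generated submodule of the closure of `S` into `S`. -/
lemma exists_smul_mem_of_fg {S T : Submodule R M} (hT : T.FG) (hTS : T ≤ wClosure S) :
    ∃ J : Ideal R, IsGVIdeal R J ∧ ∀ j ∈ J, ∀ x ∈ T, j • x ∈ S := by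
  induction T, hT using Submodule.fg_induction with
  | singleton x =>
    obtain ⟨J, hJ, hx⟩ := hTS (Submodule.mem_span_singleton_self x)
    refine ⟨J, hJ, fun j hj y hy => ?_⟩
    obtain ⟨r, rfl⟩ := Submodule.mem_span_singleton.1 hy
    rw [smul_comm]
    exact S.smul_mem r (hx j hj)
  | sup T₁ T₂ _ _ ih₁ ih₂ =>
    obtain ⟨I, hI, h₁⟩ := ih₁ (le_sup_left.trans hTS)
    obtain ⟨J, hJ, h₂⟩ := ih₂ (le_sup_right.trans hTS)
    refine ⟨I * J, hI.mul hJ, fun j hj x hx => ?_⟩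
    obtain ⟨y, hy, z, hz, rfl⟩ := Submodule.mem_sup.1 hx
    rw [smul_add]
    exact S.add_mem (h₁ j (Ideal.mul_le_left hj) y hy) (h₂ j (Ideal.mul_le_right hj) z hz)

lemma wClosure_wClosure (S : Submodule R M) : wClosure (wClosure S) = wClosure S := by
  refine le_antisymm (fun x ⟨J, hJ, hx⟩ => ?_) (le_wClosure _)
  obtain ⟨I, hI, h⟩ := exists_smul_mem_of_fg (S := S)
    (T := Submodule.map (LinearMap.toSpanSingleton R M x) J) (Submodule.FG.map _ hJ.1)
    (by rintro _ ⟨j, hj, rfl⟩; exact hx j hj)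
  refine ⟨I * J, hI.mul hJ, fun k hk => ?_⟩
  refine Submodule.mul_induction_on hk (fun i hi j hj => ?_) fun a b ha hb => ?_
  · rw [mul_smul]
    exact h i hi _ ⟨j, hj, rfl⟩
  · rw [add_smul]
    exact S.add_mem ha hb

lemma isGVTorsionFree_quotient_wClosure (S : Submodule R M) :
    IsGVTorsionFree R (M ⧸ wClosure S) := by
  rintro x ⟨J, hJ, hx⟩
  obtain ⟨x, rfl⟩ := Submodule.Quotient.mk_surjective _ x
  rw [Submodule.Quotient.mk_eq_zero, ← wClosure_wClosure]
  exact ⟨J, hJ, fun j hj => (Submodule.Quotient.mk_eq_zero _).1 (hx j hj)⟩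

lemma isGVTorsion_quotient_iff {S : Submodule R M} :
    IsGVTorsion R (M ⧸ S) ↔ wClosure S = ⊤ := by
  rw [eq_top_iff]
  refine ⟨fun h x _ => ?_, fun h x => ?_⟩
  · obtain ⟨J, hJ, hx⟩ := h (Submodule.Quotient.mk x)
    exact ⟨J, hJ, fun j hj => (Submodule.Quotient.mk_eq_zero _).1 (hx j hj)⟩
  · obtain ⟨x, rfl⟩ := Submodule.Quotient.mk_surjective _ x
    obtain ⟨J, hJ, hx⟩ := h (trivial : x ∈ ⊤)
    exact ⟨J, hJ, fun j hj => (Submodule.Quotient.mk_eq_zero _).2 (hx j hj)⟩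

lemma torGV_eq_wClosure : torGV R M = wClosure ⊥ :=
  Submodule.span_eq (wClosure (⊥ : Submodule R M))

lemma isGVTorsionFree_quotient_torGV : IsGVTorsionFree R (M ⧸ torGV R M) := by
  rw [torGV_eq_wClosure]
  exact isGVTorsionFree_quotient_wClosure _

lemma isGVTorsion_torGV : IsGVTorsion R (torGV R M) := by
  rw [torGV_eq_wClosure]
  rintro ⟨x, J, hJ, hx⟩
  exact ⟨J, hJ, fun j hj => Subtype.ext (hx j hj)⟩

lemma IsGVTorsionFree.of_injective {N : Type} [AddCommGroup N] [Module R N]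
    (hN : IsGVTorsionFree R N) (f : M →ₗ[R] N) (hf : Function.Injective f) :
    IsGVTorsionFree R M := by
  rintro x ⟨J, hJ, hx⟩
  refine hf ((hN _ ⟨J, hJ, fun j hj => ?_⟩).trans (map_zero f).symm)
  rw [← map_smul, hx j hj, map_zero]

lemma IsGVTorsionFree.pi {ι : Type} {N : ι → Type} [∀ i, AddCommGroup (N i)]
    [∀ i, Module R (N i)] (hN : ∀ i, IsGVTorsionFree R (N i)) :
    IsGVTorsionFree R (∀ i, N i) := by
  rintro x ⟨J, hJ, hx⟩
  exact funext fun i => hN i _ ⟨J, hJ, fun j hj => congrFun (hx j hj) i⟩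

end GVClosure

section MaxWIdeals

variable {R : Type} [CommRing R]

lemma isWIdeal_iff {I : Ideal R} : IsWIdeal R I ↔ wClosure I ≤ I :=
  Iff.rfl

lemma isWIdeal_wClosure (I : Ideal R) : IsWIdeal R (wClosure I) :=
  isWIdeal_iff.2 (wClosure_wClosure I).le

lemma IsMaxWIdeal.not_le {P J : Ideal R} (hP : IsMaxWIdeal R P) (hJ : IsGVIdeal R J) :
    ¬ J ≤ P :=
  fun h => hP.2.1 ((Ideal.eq_top_iff_one _).2 (hP.1 1 ⟨J, hJ, fun j hj => by simpa using h hj⟩))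

lemma IsMaxWIdeal.isPrime {P : Ideal R} (hP : IsMaxWIdeal R P) : P.IsPrime := by
  refine ⟨hP.2.1, fun {a b} hab => or_iff_not_imp_left.2 fun ha => ?_⟩
  let I : Ideal R := Submodule.comap (LinearMap.mulRight R b) P
  have hI (x : R) : x ∈ I ↔ x * b ∈ P := Iff.rfl
  have hIw : IsWIdeal R I := by
    rintro x ⟨J, hJ, hx⟩
    refine hP.1 _ ⟨J, hJ, fun j hj => ?_⟩
    simpa [mul_assoc] using (hI _).1 (hx j hj)
  by_contra hb
  have h1 : I ≠ ⊤ := fun h => hb (by simpa using (hI 1).1 (h ▸ Submodule.mem_top))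
  have h2 : I = P := hP.2.2 I hIw h1 fun x hx => P.mul_mem_right b hx
  exact ha (h2 ▸ (hI a).2 hab)

lemma exists_isMaxWIdeal_le {I : Ideal R} (hI : IsWIdeal R I) (hI' : I ≠ ⊤) :
    ∃ P : Ideal R, IsMaxWIdeal R P ∧ I ≤ P := by
  suffices h : ∀ c ⊆ {I : Ideal R | IsWIdeal R I ∧ I ≠ ⊤}, IsChain (· ≤ ·) c → ∀ K ∈ c,
      ∃ ub ∈ {I : Ideal R | IsWIdeal R I ∧ I ≠ ⊤}, ∀ L ∈ c, L ≤ ub by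
    obtain ⟨P, hIP, hP⟩ := zorn_le_nonempty₀ _ h I ⟨hI, hI'⟩
    exact ⟨P, ⟨hP.prop.1, hP.prop.2, fun K hK hK' h => (hP.eq_of_le ⟨hK, hK'⟩ h).symm⟩, hIP⟩
  intro c hc hchain K hK
  have hdir := hchain.directedOn
  refine ⟨sSup c, ⟨?_, ?_⟩, fun _ h => le_sSup h⟩
  · rintro x ⟨J, hJ, hx⟩
    have hfg : (Submodule.map (LinearMap.mulRight R x) J).FG := Submodule.FG.map _ hJ.1
    obtain ⟨L, hL, hle⟩ := (CompleteLattice.isCompactElement_iff_le_of_directed_sSup_le _ _).1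
      ((Submodule.fg_iff_compact _).1 hfg) c ⟨K, hK⟩ hdir
      (by rintro _ ⟨j, hj, rfl⟩; exact hx j hj)
    exact le_sSup hL ((hc hL).1 x ⟨J, hJ, fun j hj => hle ⟨j, hj, rfl⟩⟩)
  · rw [Ne, Ideal.eq_top_iff_one, Submodule.mem_sSup_of_directed ⟨K, hK⟩ hdir]
    rintro ⟨L, hL, h⟩
    exact (hc hL).2 ((Ideal.eq_top_iff_one _).2 h)

variable {M : Type} [AddCommGroup M] [Module R M]

/-- The closure of a submodule is computed by localizing at the maximal `w`-ideals. -/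
lemma mem_wClosure_iff {S : Submodule R M} {x : M} :
    x ∈ wClosure S ↔ ∀ P : Ideal R, IsMaxWIdeal R P → ∃ s ∉ P, s • x ∈ S := by
  refine ⟨fun ⟨J, hJ, hx⟩ P hP => ?_, fun h => ?_⟩
  · obtain ⟨s, hs, hsP⟩ := Set.not_subset.1 (hP.not_le hJ)
    exact ⟨s, hsP, hx s hs⟩
  · let I : Ideal R := S.comap (LinearMap.toSpanSingleton R M x)
    have hI (r : R) : r ∈ I ↔ r • x ∈ S := Iff.rfl
    have htop : wClosure I = ⊤ := by
      by_contra hne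
      obtain ⟨P, hP, hle⟩ := exists_isMaxWIdeal_le (isWIdeal_wClosure I) hne
      obtain ⟨s, hs, hsx⟩ := h P hP
      exact hs (hle (le_wClosure I ((hI s).2 hsx)))
    obtain ⟨J, hJ, h1⟩ := htop.ge (trivial : (1 : R) ∈ ⊤)
    exact ⟨J, hJ, fun j hj => (hI j).1 (by simpa using h1 j hj)⟩

lemma locMap_mk (S : Submonoid R) {A B : Type} [AddCommGroup A] [Module R A] [AddCommGroup B]
    [Module R B] (f : A →ₗ[R] B) (a : A) (s : S) :
    locMap R S f (LocalizedModule.mk a s) = LocalizedModule.mk (f a) s := by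
  rw [IsLocalizedModule.mk_eq_mk', IsLocalizedModule.mk_eq_mk']
  exact IsLocalizedModule.map_mk' S (LocalizedModule.mkLinearMap S A)
    (LocalizedModule.mkLinearMap S B) f a s

lemma IsWEpi.wClosure_range_eq_top {A B : Type} [AddCommGroup A] [Module R A] [AddCommGroup B]
    [Module R B] {f : A →ₗ[R] B} (hf : IsWEpi R f) : wClosure (LinearMap.range f) = ⊤ := by
  refine eq_top_iff.2 fun b _ => mem_wClosure_iff.2 fun P hP => ?_
  have := hP.isPrime
  obtain ⟨a, ha⟩ := hf P hP (LocalizedModule.mk b 1)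
  induction a using LocalizedModule.induction_on with | h a s
  rw [locMap_mk, LocalizedModule.mk_eq] at ha
  obtain ⟨u, hu⟩ := ha
  refine ⟨u * s, (u * s).2, u • a, ?_⟩
  simpa [Submonoid.smul_def, mul_smul] using hu

lemma exact_locMap {A B C : Type} [AddCommGroup A] [Module R A] [AddCommGroup B]
    [Module R B] [AddCommGroup C] [Module R C] {f : A →ₗ[R] B} {g : B →ₗ[R] C}
    (h1 : LinearMap.range f ≤ LinearMap.ker g) (h2 : LinearMap.ker g ≤ wClosure (LinearMap.range f))
    {P : Ideal R} (hP : IsMaxWIdeal R P) [P.IsPrime] :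
    Function.Exact (locMap R P.primeCompl f) (locMap R P.primeCompl g) := by
  intro y
  constructor
  · intro hy
    induction y using LocalizedModule.induction_on with | h b s
    rw [locMap_mk, ← LocalizedModule.zero_mk s, LocalizedModule.mk_eq] at hy
    obtain ⟨u, hu⟩ := hy
    have hus : (u * s : R) • b ∈ LinearMap.ker g := by
      simpa [Submonoid.smul_def, mul_smul] using hu
    obtain ⟨t, ht, a, ha⟩ := mem_wClosure_iff.1 (h2 hus) P hP
    refine ⟨LocalizedModule.mk a (⟨t, ht⟩ * u * s * s), ?_⟩
    rw [locMap_mk, ha, LocalizedModule.mk_eq]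
    refine ⟨1, ?_⟩
    simp only [Submonoid.smul_def, Submonoid.coe_mul, OneMemClass.coe_one, smul_smul]
    congr 1
    ring
  · rintro ⟨x, rfl⟩
    induction x using LocalizedModule.induction_on with | h a s
    rw [locMap_mk, locMap_mk, show g (f a) = 0 from h1 ⟨a, rfl⟩, LocalizedModule.zero_mk]

end MaxWIdeals

section WModules

variable {R : Type} [CommRing R] {N : Type} [AddCommGroup N] [Module R N]

lemma isWModule_iff : IsWModule R N ↔ IsGVTorsionFree R N ∧
    ∀ J : Ideal R, IsGVIdeal R J → ∀ u : J →ₗ[R] N, ∃ n : N, ∀ j : J, u j = (j : R) • n := by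
  refine and_congr_right fun _ => forall_congr' fun J => forall_congr' fun _ => ?_
  have hf : Function.Injective J.subtype := J.injective_subtype
  have hfg : Function.Exact J.subtype J.mkQ := LinearMap.exact_subtype_mkQ J
  have hg : Function.Surjective J.mkQ := J.mkQ_surjective
  rw [subsingleton_extM_iff (R ⧸ J) N 0]
  refine ⟨fun h u => ?_, fun h => subsingleton_extD_one hf hfg hg fun u => ?_⟩
  · obtain ⟨v, rfl⟩ := exists_extend_of_subsingleton_extD hf hfg hg h u
    refine ⟨v 1, fun j => ?_⟩
    rw [← map_smul]
    simp
  · obtain ⟨n, hn⟩ := h u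
    exact ⟨LinearMap.toSpanSingleton R N n, LinearMap.ext fun j => (hn j).symm⟩

lemma isGVTorsionFree_self : IsGVTorsionFree R R := by
  rintro x ⟨J, hJ, hx⟩
  exact (isGVIdeal_iff.1 hJ).2.1 x fun j hj => by simpa [mul_comm] using hx j hj

lemma isWModule_finsupp (X : Type) : IsWModule R (X →₀ R) := by
  refine isWModule_iff.2 ⟨(IsGVTorsionFree.pi fun _ : X => isGVTorsionFree_self).of_injective
    Finsupp.lcoeFun DFunLike.coe_injective, fun J hJ u => ?_⟩
  obtain ⟨⟨G, hG⟩, hJ1, hJ2⟩ := isGVIdeal_iff.1 hJ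
  choose r hr using fun x => hJ2 (Finsupp.lapply x ∘ₗ u)
  have hGJ (g : G) : (g : R) ∈ J := hG ▸ Ideal.subset_span g.2
  have hfin : (Function.support r).Finite := by
    refine (Set.finite_iUnion fun g : G => (u ⟨g, hGJ g⟩).hasFiniteSupport).subset fun x hx => ?_
    by_contra hx'
    refine hx (hJ1 _ fun j hj => ?_)
    rw [← hG] at hj
    induction hj using Submodule.span_induction with
    | mem g hg =>
      rw [← hr x ⟨g, hGJ ⟨g, hg⟩⟩]
      by_contra hne
      exact hx' (Set.mem_iUnion.2 ⟨⟨g, hg⟩, hne⟩)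
    | zero => exact mul_zero _
    | add a b _ _ ha hb => rw [mul_add, ha, hb, add_zero]
    | smul c a _ ha => rw [smul_eq_mul, mul_left_comm, ha, mul_zero]
  refine ⟨Finsupp.ofSupportFinite r hfin, fun j => Finsupp.ext fun x => ?_⟩
  exact (hr x j).trans (mul_comm _ _)

lemma IsWModule.ker {L : Type} [AddCommGroup L] [Module R L] (hN : IsWModule R N)
    (hL : IsGVTorsionFree R L) (q : N →ₗ[R] L) : IsWModule R (LinearMap.ker q) := by
  rw [isWModule_iff] at hN ⊢
  refine ⟨hN.1.of_injective _ (Submodule.injective_subtype _), fun J hJ u => ?_⟩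
  obtain ⟨n, hn⟩ := hN.2 J hJ (Submodule.subtype _ ∘ₗ u)
  refine ⟨⟨n, hL _ ⟨J, hJ, fun j hj => ?_⟩⟩, fun j => Subtype.ext (hn j)⟩
  rw [← map_smul, ← hn ⟨j, hj⟩]
  exact (u ⟨j, hj⟩).2

lemma isWModule_wClosure {E : Type} [AddCommGroup E] [Module R E] [Module.Injective R E]
    (hE : IsGVTorsionFree R E) (S : Submodule R E) : IsWModule R (wClosure S) := by
  refine isWModule_iff.2 ⟨hE.of_injective _ (Submodule.injective_subtype _), fun J hJ u => ?_⟩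
  obtain ⟨h, hh⟩ := Module.Injective.out J.subtype J.injective_subtype
    ((wClosure S).subtype ∘ₗ u)
  have key (j : J) : (u j : E) = (j : R) • h 1 := by
    rw [← map_smul]
    simpa using (hh j).symm
  refine ⟨⟨h 1, ?_⟩, fun j => Subtype.ext (key j)⟩
  rw [← wClosure_wClosure]
  exact ⟨J, hJ, fun j hj => key ⟨j, hj⟩ ▸ (u ⟨j, hj⟩).2⟩

variable (R) in
/-- The product of the duals of the localizations at all maximal `w`-ideals: a
GV-torsion-free injective cogenerator for the GV-torsion-free modules. -/
abbrev WCogenerator : Type :=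
  ∀ P : {P : PrimeSpectrum R // IsMaxWIdeal R P.asIdeal},
    CharacterModule (Localization.AtPrime P.1.asIdeal)

instance : Module.Injective R (WCogenerator R) :=
  have (P : {P : PrimeSpectrum R // IsMaxWIdeal R P.asIdeal}) :
      Module.Injective R (CharacterModule (Localization.AtPrime P.1.asIdeal)) :=
    Module.Flat.iff_characterModule_injective.1 (IsLocalization.flat _ P.1.asIdeal.primeCompl)
  Module.Injective.pi R _

lemma isGVTorsionFree_wCogenerator : IsGVTorsionFree R (WCogenerator R) := by
  refine IsGVTorsionFree.pi fun P => ?_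
  rintro φ ⟨J, hJ, hφ⟩
  obtain ⟨s, hs, hsP⟩ := Set.not_subset.1 (P.2.not_le hJ)
  refine CharacterModule.ext _ fun y => ?_
  obtain ⟨z, hz⟩ := IsUnit.dvd (a := y) (IsLocalization.map_units
    (Localization.AtPrime P.1.asIdeal) (⟨s, hsP⟩ : P.1.asIdeal.primeCompl))
  rw [hz, ← Algebra.smul_def]
  exact DFunLike.congr_fun (hφ s hs) z

lemma exists_character_of_forall_smul_notMem (P : Ideal R) [P.IsPrime] {S : Submodule R N} {a : N}
    (h : ∀ s ∉ P, s • a ∉ S) : ∃ φ : N →ₗ[R] CharacterModule (Localization.AtPrime P),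
      S ≤ LinearMap.ker φ ∧ φ a ≠ 0 := by
  let ι : N →ₗ[R] LocalizedModule P.primeCompl (N ⧸ S) :=
    LocalizedModule.mkLinearMap _ _ ∘ₗ S.mkQ
  have ha : ι a ≠ 0 := by
    intro h0
    obtain ⟨⟨s, hs⟩, hs0⟩ := (LocalizedModule.mk_eq (S := P.primeCompl)).1
      (h0.trans (LocalizedModule.zero_mk 1).symm)
    refine h s hs ((Submodule.Quotient.mk_eq_zero S).1 ?_)
    simpa [Submonoid.smul_def] using hs0
  obtain ⟨c, hc⟩ := CharacterModule.exists_character_apply_ne_zero_of_ne_zero ha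
  let ψ : LocalizedModule P.primeCompl (N ⧸ S) →ₗ[R] CharacterModule (Localization.AtPrime P) :=
    { toFun := fun x => AddMonoidHom.comp c (LinearMap.toSpanSingleton _ _ x).toAddMonoidHom
      map_add' := fun x y => CharacterModule.ext _ fun r =>
        (congrArg c (smul_add r x y)).trans (map_add c _ _)
      map_smul' := fun r x => CharacterModule.ext _ fun t =>
        congrArg c ((smul_comm t r x).trans (smul_assoc r t x).symm) }
  have hψ (x) : ψ x 1 = c x := congrArg c (one_smul (Localization.AtPrime P) x)
  refine ⟨ψ ∘ₗ ι, fun x hx => ?_, fun h0 => hc ?_⟩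
  · have : ι x = 0 := by
      simp [ι, (Submodule.Quotient.mk_eq_zero S).2 hx]
    simp [this]
  · rw [← hψ]
    exact DFunLike.congr_fun h0 1

lemma mem_wClosure_of_forall_wCogenerator {S : Submodule R N} {a : N}
    (h : ∀ φ : N →ₗ[R] WCogenerator R, S ≤ LinearMap.ker φ → φ a = 0) : a ∈ wClosure S := by
  classical
  refine mem_wClosure_iff.2 fun P hP => ?_
  by_contra! hne
  have := hP.isPrime
  obtain ⟨φ, hφ, ha⟩ := exists_character_of_forall_smul_notMem P hne
  let P' : {P : PrimeSpectrum R // IsMaxWIdeal R P.asIdeal} := ⟨⟨P, hP.isPrime⟩, hP⟩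
  refine ha ?_
  have := congrFun (h (LinearMap.single R
    (fun P : {P : PrimeSpectrum R // IsMaxWIdeal R P.asIdeal} =>
      CharacterModule (Localization.AtPrime P.1.asIdeal)) P' ∘ₗ φ) ?_) P'
  · simpa using this
  · exact fun x hx => by simp [show φ x = 0 from hφ hx]

lemma exists_isWEnvelope (hN : IsGVTorsionFree R N) :
    ∃ (L : Type) (_ : AddCommGroup L) (_ : Module R L) (ι : N →ₗ[R] L), IsWEnvelope R N L ι := by
  have : Module.Injective R ((N →ₗ[R] WCogenerator R) → WCogenerator R) :=
    Module.Injective.pi R _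
  let f : N →ₗ[R] (N →ₗ[R] WCogenerator R) → WCogenerator R := LinearMap.pi fun φ => φ
  have hf : Function.Injective f := by
    refine (injective_iff_map_eq_zero f).2 fun x hx => hN x ?_
    exact mem_wClosure_of_forall_wCogenerator (S := ⊥) fun φ _ => congrFun hx φ
  refine ⟨wClosure (LinearMap.range f), inferInstance, inferInstance,
    f.codRestrict _ fun x => le_wClosure _ ⟨x, rfl⟩,
    isWModule_wClosure (IsGVTorsionFree.pi fun _ => isGVTorsionFree_wCogenerator) _,
    fun x y hxy => hf (congrArg Subtype.val hxy), isGVTorsion_quotient_iff.2 ?_⟩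
  refine eq_top_iff.2 fun ⟨x, J, hJ, hx⟩ _ => ⟨J, hJ, fun j hj => ?_⟩
  obtain ⟨y, hy⟩ := hx j hj
  exact ⟨y, Subtype.ext hy⟩

/-- For every `j` in some GV-ideal, multiplication by `j` on `L` factors through a free module
covering `L`. -/
lemma IsWProjective.exists_smul_lift {M : Type} [AddCommGroup M] [Module R M]
    (hM : IsWProjective R M) {L : Type} [AddCommGroup L] [Module R L]
    {ι : (M ⧸ torGV R M) →ₗ[R] L} (hL : IsWEnvelope R (M ⧸ torGV R M) L ι) :
    ∃ J : Ideal R, IsGVIdeal R J ∧ ∀ j ∈ J, ∃ p : L →ₗ[R] L →₀ R,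
      ∀ x, Finsupp.linearCombination R id (p x) = j • x := by
  have hK := (isWModule_finsupp (R := R) L).ker hL.1.1 (Finsupp.linearCombination R id)
  have hf := Submodule.injective_subtype (LinearMap.ker (Finsupp.linearCombination R (id : L → L)))
  have hfg := LinearMap.exact_subtype_ker_map (Finsupp.linearCombination R (id : L → L))
  have hg : Function.Surjective (Finsupp.linearCombination R (id : L → L)) :=
    Finsupp.linearCombination_surjective R Function.surjective_id
  obtain ⟨J, hJ, h⟩ := isGVTorsion_extD _ _ 0 (hM _ hK.1 hK L ι hL)
    (shortExact_shortComplexOfExact hf hfg hg).extClass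
  exact ⟨J, hJ, fun j hj => exists_smul_lift_of_smul_extClass_eq_zero hf hfg hg j (h j hj)⟩

end WModules

section ExtVanishing

variable {R : Type} [CommRing R]

lemma exists_extend_of_ker_le {A B E : Type} [AddCommGroup A] [Module R A] [AddCommGroup B]
    [Module R B] [AddCommGroup E] [Module R E] [Module.Injective R E] (h : A →ₗ[R] B)
    (u : A →ₗ[R] E) (hu : LinearMap.ker h ≤ LinearMap.ker u) : ∃ v : B →ₗ[R] E, v ∘ₗ h = u := by
  obtain ⟨v, hv⟩ := Module.Injective.out ((LinearMap.ker h).liftQ h le_rfl)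
    (LinearMap.ker_eq_bot.1 (Submodule.ker_liftQ_eq_bot' _ _ rfl)) ((LinearMap.ker h).liftQ u hu)
  exact ⟨v, LinearMap.ext fun x => hv (Submodule.Quotient.mk x)⟩

/-- The families that vanish eventually along a filter. -/
def eventuallyZero {D : Type} (l : Filter D) (E : D → Type) [∀ α, AddCommGroup (E α)]
    [∀ α, Module R (E α)] : Submodule R (∀ α, E α) where
  carrier := {e | ∀ᶠ α in l, e α = 0}
  zero_mem' := Filter.Eventually.of_forall fun _ => rfl
  add_mem' hx hy := by
    filter_upwards [hx, hy] with α h h'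
    simp [h, h']
  smul_mem' r _ hx := by
    filter_upwards [hx] with α h
    simp [h]

/-- Multiplication by each element of some GV-ideal factors through a free module. -/
def AlmostProjective (L : Type) [AddCommGroup L] [Module R L] : Prop :=
  ∃ J : Ideal R, IsGVIdeal R J ∧ ∀ j ∈ J, ∃ (Y : Type) (a : L →ₗ[R] Y →₀ R)
    (b : (Y →₀ R) →ₗ[R] L), ∀ x, b (a x) = j • x

lemma AlmostProjective.exists_endomorphism {L : Type} [AddCommGroup L] [Module R L] {J : Ideal R}
    (hL : ∀ j ∈ J, ∃ (Y : Type) (a : L →ₗ[R] Y →₀ R) (b : (Y →₀ R) →ₗ[R] L), ∀ x, b (a x) = j • x)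
    {F : Type} [AddCommGroup F] [Module R F] {q : F →ₗ[R] L}
    (hq : Function.Surjective q) {j : R} (hj : j ∈ J) :
    ∃ s : F →ₗ[R] LinearMap.ker q, ∀ k : LinearMap.ker q, s k = j • k := by
  obtain ⟨Y, a, b, hab⟩ := hL j hj
  obtain ⟨c, hc⟩ := Module.projective_lifting_property q b hq
  refine ⟨LinearMap.codRestrict _ (j • LinearMap.id - c ∘ₗ a ∘ₗ q) fun x => ?_, fun k => ?_⟩
  · have := LinearMap.congr_fun hc (a (q x))
    simp only [LinearMap.comp_apply, hab] at this
    simp [this]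
  · ext
    simp [show q k = 0 from k.2]

lemma AlmostProjective.ker {L X : Type} [AddCommGroup L] [Module R L]
    (hL : AlmostProjective (R := R) L) {q : (X →₀ R) →ₗ[R] L} (hq : Function.Surjective q) :
    AlmostProjective (R := R) (LinearMap.ker q) := by
  obtain ⟨J, hJ, h⟩ := hL
  refine ⟨J, hJ, fun j hj => ?_⟩
  obtain ⟨s, hs⟩ := AlmostProjective.exists_endomorphism h hq hj
  exact ⟨X, Submodule.subtype _, s, hs⟩

lemma AlmostProjective.quotient {J : Ideal R} (hJ : IsGVIdeal R J) :
    AlmostProjective (R := R) (R ⧸ J) := by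
  refine ⟨J, hJ, fun j hj => ⟨Empty, 0, 0, fun x => ?_⟩⟩
  obtain ⟨x, rfl⟩ := J.mkQ_surjective x
  rw [← map_smul, eq_comm]
  exact (Submodule.Quotient.mk_eq_zero J).2 (J.mul_mem_right x hj)

section

variable {D : Type} (l : Filter D) {E : D → Type} [∀ α, AddCommGroup (E α)]
    [∀ α, Module R (E α)] [∀ α, Module.Injective R (E α)]

lemma AlmostProjective.exists_extend (hE : ∀ α, IsGVTorsionFree R (E α)) {L X : Type}
    [AddCommGroup L] [Module R L] (hL : AlmostProjective (R := R) L) {q : (X →₀ R) →ₗ[R] L}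
    (hq : Function.Surjective q)
    (ψ : LinearMap.ker q →ₗ[R] eventuallyZero (R := R) l E) :
    ∃ v : (X →₀ R) →ₗ[R] eventuallyZero (R := R) l E, v ∘ₗ (LinearMap.ker q).subtype = ψ := by
  obtain ⟨J, hJ, h⟩ := hL
  obtain ⟨G, hG⟩ := hJ.1
  have hGJ (g : G) : (g : R) ∈ J := hG ▸ Ideal.subset_span g.2
  choose s hs using fun g : G => AlmostProjective.exists_endomorphism h hq (hGJ g)
  let ψc (α : D) : LinearMap.ker q →ₗ[R] E α :=
    LinearMap.proj α ∘ₗ (eventuallyZero (R := R) l E).subtype ∘ₗ ψ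
  let S (α : D) : Submodule R (X →₀ R) := Submodule.span R
    {y | (∃ x, y = Finsupp.single x 1) ∧ ∀ g, ψc α (s g y) = 0}
  have hS (α : D) (g : G) (y) (hy : y ∈ S α) : ψc α (s g y) = 0 := by
    have : S α ≤ LinearMap.ker (ψc α ∘ₗ s g) := Submodule.span_le.2 fun y hy => hy.2 g
    exact this hy
  have hτ (α : D) : ∃ v : ((X →₀ R) ⧸ S α) →ₗ[R] E α,
      v ∘ₗ ((S α).mkQ ∘ₗ (LinearMap.ker q).subtype) = ψc α := by
    refine exists_extend_of_ker_le (A := LinearMap.ker q)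
      ((S α).mkQ ∘ₗ (LinearMap.ker q).subtype) (ψc α) fun k hk => hE α _ ⟨J, hJ, fun j hj => ?_⟩
    have hkS : (k : X →₀ R) ∈ S α := by simpa using hk
    rw [← hG] at hj
    induction hj using Submodule.span_induction with
    | mem g hg =>
      rw [← map_smul, ← hs ⟨g, hg⟩]
      exact hS α ⟨g, hg⟩ k hkS
    | zero => exact zero_smul _ _
    | add a b _ _ ha hb => rw [add_smul, ha, hb, add_zero]
    | smul c a _ ha => rw [smul_assoc, ha, smul_zero]
  choose v hv using hτ
  let τ : (X →₀ R) →ₗ[R] (∀ α, E α) := LinearMap.pi fun α => v α ∘ₗ (S α).mkQ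
  have hτN (y : X →₀ R) : τ y ∈ eventuallyZero (R := R) l E := by
    induction y using Finsupp.induction_linear with
    | zero => rw [map_zero]; exact zero_mem _
    | add f g hf hg => rw [map_add]; exact add_mem hf hg
    | single x r =>
      rw [← mul_one r, ← smul_eq_mul, ← Finsupp.smul_single, map_smul]
      refine Submodule.smul_mem _ _ ?_
      have := Filter.eventually_all.2 fun g : G => (ψ (s g (Finsupp.single x 1))).2
      filter_upwards [this] with α hα
      have : Finsupp.single x (1 : R) ∈ S α := Submodule.subset_span ⟨⟨x, rfl⟩, hα⟩
      simp [τ, (Submodule.Quotient.mk_eq_zero (S α)).2 this]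
  refine ⟨τ.codRestrict _ hτN, LinearMap.ext fun k => Subtype.ext (funext fun α => ?_)⟩
  exact LinearMap.congr_fun (hv α) k

/-- The modules of eventually vanishing families do not see extensions of almost projective
modules. -/
lemma AlmostProjective.subsingleton_extD (hE : ∀ α, IsGVTorsionFree R (E α)) (n : ℕ) :
    ∀ (L : Type) [AddCommGroup L] [Module R L], AlmostProjective (R := R) L →
      Subsingleton (ExtD (R := R) L (eventuallyZero (R := R) l E) (n + 1)) := by
  induction n with
  | zero =>
    intro L _ _ hL
    have hq := Finsupp.linearCombination_surjective R (Function.surjective_id (α := L))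
    exact subsingleton_extD_one (Submodule.injective_subtype _) (LinearMap.exact_subtype_ker_map _)
      hq (hL.exists_extend l hE hq)
  | succ n ih =>
    intro L _ _ hL
    have hq := Finsupp.linearCombination_surjective R (Function.surjective_id (α := L))
    exact subsingleton_extD_right (Submodule.injective_subtype _)
      (LinearMap.exact_subtype_ker_map _) hq (ih _ (hL.ker hq)) (subsingleton_extD_of_projective _)

end

lemma exact_lmap {X : Type} {A B C : X → Type} [∀ x, AddCommGroup (A x)] [∀ x, Module R (A x)]
    [∀ x, AddCommGroup (B x)] [∀ x, Module R (B x)] [∀ x, AddCommGroup (C x)]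
    [∀ x, Module R (C x)] {f : ∀ x, A x →ₗ[R] B x} {g : ∀ x, B x →ₗ[R] C x}
    (h : ∀ x, Function.Exact (f x) (g x)) :
    Function.Exact (DirectSum.lmap f) (DirectSum.lmap g) := by
  classical
  rw [LinearMap.exact_iff, DirectSum.ker_lmap, DirectSum.range_lmap]
  simp_rw [fun x => LinearMap.exact_iff.1 (h x)]

lemma subsingleton_extD_directSum {X : Type} {N : Type} [AddCommGroup N] [Module R N] (n : ℕ) :
    ∀ (L : X → Type) [∀ x, AddCommGroup (L x)] [∀ x, Module R (L x)],
      (∀ m x, Subsingleton (ExtD (R := R) (L x) N (m + 1))) →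
      Subsingleton (ExtD (R := R) (DirectSum X L) N (n + 1)) := by
  classical
  induction n with
  | zero =>
    intro L _ _ hL
    let q (x : X) : (L x →₀ R) →ₗ[R] L x := Finsupp.linearCombination R id
    have hq (x : X) : Function.Surjective (q x) :=
      Finsupp.linearCombination_surjective R Function.surjective_id
    have hinj (x : X) := Submodule.injective_subtype (LinearMap.ker (q x))
    have hex (x : X) := LinearMap.exact_subtype_ker_map (q x)
    refine subsingleton_extD_one ((DirectSum.lmap_injective _).2 hinj) (exact_lmap hex)
      ((DirectSum.lmap_surjective _).2 hq) fun u => ?_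
    have hv (x : X) : ∃ v : (L x →₀ R) →ₗ[R] N,
        v ∘ₗ (LinearMap.ker (q x)).subtype =
          u ∘ₗ DirectSum.lof R X (fun x => LinearMap.ker (q x)) x :=
      exists_extend_of_subsingleton_extD (R := R) (A := LinearMap.ker (q x)) (B := L x →₀ R)
        (C := L x) (hinj x) (hex x) (hq x) (hL 0 x) _
    choose v hv using hv
    refine ⟨DirectSum.toModule R X N v, DirectSum.linearMap_ext R fun x => ?_⟩
    rw [← hv]
    ext k
    simp
  | succ n ih =>
    intro L _ _ hL
    let q (x : X) : (L x →₀ R) →ₗ[R] L x := Finsupp.linearCombination R id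
    have hq (x : X) : Function.Surjective (q x) :=
      Finsupp.linearCombination_surjective R Function.surjective_id
    have hinj (x : X) := Submodule.injective_subtype (LinearMap.ker (q x))
    have hex (x : X) := LinearMap.exact_subtype_ker_map (q x)
    refine subsingleton_extD_right ((DirectSum.lmap_injective _).2 hinj) (exact_lmap hex)
      ((DirectSum.lmap_surjective _).2 hq) (ih (fun x => LinearMap.ker (q x)) fun m x => ?_)
      (subsingleton_extD_of_projective _)
    exact subsingleton_extD_left (hinj x) (hex x) (hq x) (subsingleton_extD_of_projective m)
      (hL (m + 1) x)

end ExtVanishing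

section EventuallyVanishing

variable {R : Type} [CommRing R] {D : Type} (l : Filter D) {E : D → Type}
  [∀ α, AddCommGroup (E α)] [∀ α, Module R (E α)]

lemma isGVTorsionFree_eventuallyZero (hE : ∀ α, IsGVTorsionFree R (E α)) :
    IsGVTorsionFree R (eventuallyZero (R := R) l E) :=
  (IsGVTorsionFree.pi hE).of_injective _ (Submodule.injective_subtype _)

lemma IsGVTorsion.of_injective {A B : Type} [AddCommGroup A] [Module R A] [AddCommGroup B]
    [Module R B] (hB : IsGVTorsion R B) (f : A →ₗ[R] B) (hf : Function.Injective f) :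
    IsGVTorsion R A := by
  intro x
  obtain ⟨J, hJ, h⟩ := hB (f x)
  exact ⟨J, hJ, fun j hj => hf (by rw [map_smul, h j hj, map_zero])⟩

lemma isGVTorsion_directSum {X : Type} {A : X → Type} [∀ x, AddCommGroup (A x)]
    [∀ x, Module R (A x)] (hA : ∀ x, IsGVTorsion R (A x)) : IsGVTorsion R (DirectSum X A) := by
  classical
  intro y
  change y ∈ wClosure (⊥ : Submodule R (DirectSum X A))
  induction y using DirectSum.induction_on with
  | zero => exact zero_mem _
  | of x a =>
    obtain ⟨J, hJ, h⟩ := hA x a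
    refine ⟨J, hJ, fun j hj => ?_⟩
    change j • DirectSum.lof R X A x a = 0
    rw [← map_smul, h j hj, map_zero]
  | add a b ha hb => exact add_mem ha hb

lemma isGVTorsion_quotient {J : Ideal R} (hJ : IsGVIdeal R J) : IsGVTorsion R (R ⧸ J) := by
  intro x
  obtain ⟨x, rfl⟩ := J.mkQ_surjective x
  refine ⟨J, hJ, fun j hj => ?_⟩
  rw [← map_smul]
  exact (Submodule.Quotient.mk_eq_zero J).2 (J.mul_mem_right x hj)

/-- A GV-torsion module is a quotient of a direct sum of modules `R ⧸ J` with `J` a GV-ideal. -/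
lemma IsGVTorsion.exists_cover {T : Type} [AddCommGroup T] [Module R T] (hT : IsGVTorsion R T) :
    ∃ (J : T → Ideal R) (q : DirectSum T (fun t => R ⧸ J t) →ₗ[R] T),
      (∀ t, IsGVIdeal R (J t)) ∧ Function.Surjective q := by
  classical
  choose J hJ h using hT
  refine ⟨J, DirectSum.toModule R T T fun t => (J t).liftQ (LinearMap.toSpanSingleton R T t) (h t),
    hJ, fun t => ⟨DirectSum.lof R T _ t (Submodule.Quotient.mk 1), ?_⟩⟩
  rw [DirectSum.toModule_lof]
  exact one_smul R t

variable [∀ α, Module.Injective R (E α)]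

lemma IsGVTorsion.subsingleton_extD (hE : ∀ α, IsGVTorsionFree R (E α)) (n : ℕ) :
    ∀ (T : Type) [AddCommGroup T] [Module R T], IsGVTorsion R T →
      Subsingleton (ExtD (R := R) T (eventuallyZero (R := R) l E) n) := by
  induction n with
  | zero =>
    intro T _ _ hT
    refine subsingleton_extD_zero (subsingleton_of_forall_eq 0 fun u => LinearMap.ext fun t => ?_)
    obtain ⟨J, hJ, h⟩ := hT t
    exact isGVTorsionFree_eventuallyZero l hE _
      ⟨J, hJ, fun j hj => by rw [← map_smul, h j hj, map_zero]⟩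
  | succ n ih =>
    intro T _ _ hT
    obtain ⟨J, q, hJ, hq⟩ := hT.exists_cover
    have hker : IsGVTorsion R (LinearMap.ker q) :=
      (isGVTorsion_directSum fun t => isGVTorsion_quotient (hJ t)).of_injective _
        (Submodule.injective_subtype _)
    exact subsingleton_extD_right (Submodule.injective_subtype _)
      (LinearMap.exact_subtype_ker_map q) hq (ih _ hker)
      (subsingleton_extD_directSum n _ fun m t =>
        (AlmostProjective.quotient (hJ t)).subsingleton_extD l hE m _)

lemma memPwDaggerInfty_eventuallyZero (hE : ∀ α, IsGVTorsionFree R (E α)) :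
    MemPwDaggerInfty R (eventuallyZero (R := R) l E) := by
  refine ⟨isGVTorsionFree_eventuallyZero l hE, fun M _ _ hM k hk => ?_⟩
  obtain ⟨k, rfl⟩ := Nat.exists_eq_add_of_le' hk
  rw [subsingleton_extM_iff]
  obtain ⟨L, _, _, ι, hL⟩ := exists_isWEnvelope (isGVTorsionFree_quotient_torGV (R := R) (M := M))
  obtain ⟨J, hJ, h⟩ := hM.exists_smul_lift hL
  have hL' : AlmostProjective (R := R) L := ⟨J, hJ, fun j hj => ⟨L, _, _, (h j hj).choose_spec⟩⟩
  have hquot : Subsingleton (ExtD (R := R) (M ⧸ torGV R M) (eventuallyZero (R := R) l E) (k + 1)) :=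
    subsingleton_extD_left hL.2.1 (LinearMap.exact_map_mkQ_range ι) (Submodule.mkQ_surjective _)
      (hL'.subsingleton_extD l hE k L) (hL.2.2.subsingleton_extD l hE (k + 1 + 1) _)
  exact subsingleton_extD_middle (Submodule.injective_subtype _)
    (LinearMap.exact_subtype_mkQ (torGV R M)) (Submodule.mkQ_surjective _)
    (isGVTorsion_torGV.subsingleton_extD l hE (k + 1) _) hquot

end EventuallyVanishing

section FinitelyPresentedType

variable {R : Type} [CommRing R]

/-- If maps from `A` to modules of eventually vanishing families extend to a finitely generated
overmodule, then `A` is the closure of a finitely generated submodule. -/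
lemma exists_finset_wClosure_span_eq_top {A F : Type} [AddCommGroup A] [Module R A]
    [AddCommGroup F] [Module R F] [Module.Finite R F] (i : A →ₗ[R] F)
    (h : ∀ (D : Type) (l : Filter D) (E : D → Type) [∀ α, AddCommGroup (E α)]
      [∀ α, Module R (E α)] [∀ α, Module.Injective R (E α)], (∀ α, IsGVTorsionFree R (E α)) →
      ∀ u : A →ₗ[R] eventuallyZero (R := R) l E,
        ∃ v : F →ₗ[R] eventuallyZero (R := R) l E, v ∘ₗ i = u) :
    ∃ β : Finset A, wClosure (Submodule.span R (β : Set A)) = ⊤ := by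
  classical
  let E (α : Finset A) : Type := {φ : A →ₗ[R] WCogenerator R // ∀ a ∈ α, φ a = 0} → WCogenerator R
  have (α : Finset A) : Module.Injective R (E α) := Module.Injective.pi R _
  let w : A →ₗ[R] (∀ α, E α) := LinearMap.pi fun α => LinearMap.pi fun φ => φ.1
  have hw (a : A) : w a ∈ eventuallyZero (R := R) (Filter.atTop : Filter (Finset A)) E := by
    filter_upwards [Filter.eventually_ge_atTop {a}] with α hα
    exact funext fun φ => φ.2 a (Finset.singleton_subset_iff.1 hα)
  obtain ⟨v, hv⟩ := h _ _ E (fun α => IsGVTorsionFree.pi fun _ => isGVTorsionFree_wCogenerator)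
    (w.codRestrict _ hw)
  obtain ⟨G, hG⟩ := Module.Finite.fg_top (R := R) (M := F)
  obtain ⟨β, hβ⟩ := ((Filter.eventually_all_finset G).2 fun g _ => (v g).2).exists
  have hvβ (y : F) : (v y : ∀ α, E α) β = 0 := by
    have hy : y ∈ Submodule.span R (G : Set F) := hG ▸ Submodule.mem_top
    induction hy using Submodule.span_induction with
    | mem g hg => exact hβ g hg
    | zero => simp
    | add a b _ _ ha hb => simp [ha, hb]
    | smul c a _ ha => simp [ha]
  refine ⟨β, eq_top_iff.2 fun a _ => mem_wClosure_of_forall_wCogenerator fun φ hφ => ?_⟩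
  have h1 : w a β = 0 := by
    rw [← hvβ (i a)]
    exact congrArg (fun e : eventuallyZero (R := R) _ E => (e : ∀ α, E α) β)
      (LinearMap.congr_fun hv a).symm
  exact congrFun h1 ⟨φ, fun b hb => hφ (Submodule.subset_span hb)⟩

end FinitelyPresentedType

/-- every weak `w`-projective module of finite type is of
finitely presented type. -/
theorem finitelyPresentedType_of_weakWProjective_of_finiteType (R : Type) [CommRing R]
    (M : Type) [AddCommGroup M] [Module R M]
    (h1 : IsWeakWProjective R M) (h2 : IsFiniteType R M) :
    IsFinitelyPresentedType R M := by
  obtain ⟨n, g, hg⟩ := h2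
  have hcoker : IsGVTorsion R (M ⧸ LinearMap.range g) :=
    isGVTorsion_quotient_iff.2 hg.wClosure_range_eq_top
  obtain ⟨β, hβ⟩ := exists_finset_wClosure_span_eq_top (LinearMap.ker g).subtype
    fun D l E _ _ _ hE u => by
      have hM := (subsingleton_extM_iff M _ 0).1 (h1 _ (memPwDaggerInfty_eventuallyZero l hE))
      have hrange := subsingleton_extD_left (Submodule.injective_subtype _)
        (LinearMap.exact_subtype_mkQ (LinearMap.range g)) (Submodule.mkQ_surjective _) hM
        (hcoker.subsingleton_extD l hE 2 _)
      have hex : Function.Exact (LinearMap.ker g).subtype g.rangeRestrict := by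
        rw [LinearMap.exact_iff, LinearMap.ker_rangeRestrict, Submodule.range_subtype]
      exact exists_extend_of_subsingleton_extD (Submodule.injective_subtype _) hex
        g.surjective_rangeRestrict hrange u
  let e := β.equivFin
  let f : (Fin β.card → R) →ₗ[R] (Fin n → R) :=
    Fintype.linearCombination R fun k => ((e.symm k : LinearMap.ker g) : Fin n → R)
  have hf : LinearMap.range f =
      (Submodule.span R (β : Set (LinearMap.ker g))).map (LinearMap.ker g).subtype := by
    rw [Fintype.range_linearCombination, Submodule.map_span]
    congr 1
    ext y
    simp only [Set.mem_range, Set.mem_image, e.symm.exists_congr_left, Equiv.symm_symm,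
      Equiv.symm_apply_apply, Subtype.exists, SetLike.mem_coe]
    aesop
  refine ⟨β.card, n, f, g, hg, fun P hP _ => exact_locMap ?_ (fun x hx => ?_) hP⟩
  · rw [hf]
    exact Submodule.map_subtype_le _ _
  · obtain ⟨J, hJ, h⟩ := hβ.ge (Submodule.mem_top : (⟨x, hx⟩ : LinearMap.ker g) ∈ ⊤)
    exact ⟨J, hJ, fun j hj => hf ▸ ⟨_, h j hj, rfl⟩⟩
end

section
/- Let R be a commutative ring, M a GV-torsion-free R-module, and (L, ι) a w-envelope of M. Then the quotient module L/ι(M) is weak w-projective. -/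
/-!  Background definitions for the `w`-operation theory of Wang–Kim–Qiao.  -/

open CategoryTheory

theorem subsingleton_extM_of_projective (R : Type) [CommRing R] (M N : Type)
    [AddCommGroup M] [Module R M] [AddCommGroup N] [Module R N] [Module.Projective R M]
    (n : ℕ) : Subsingleton (extM R M N (n + 1)) :=
  haveI : Projective (ModuleCat.of R M) := (IsProjective.iff_projective M).1 inferInstance
  ModuleCat.subsingleton_of_isZero (isZero_Ext_succ_of_projective _ _ n)

/-- The `w`-envelope of a zero module is zero. -/
theorem IsWEnvelope.subsingleton {R : Type} [CommRing R] {M L : Type} [AddCommGroup M]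
    [Module R M] [AddCommGroup L] [Module R L] {ι : M →ₗ[R] L} [Subsingleton M]
    (h : IsWEnvelope R M L ι) : Subsingleton L := by
  refine subsingleton_of_forall_eq 0 fun x => h.1.1 x ?_
  obtain ⟨J, hJ, hx⟩ := h.2.2 ((LinearMap.range ι).mkQ x)
  refine ⟨J, hJ, fun j hj => ?_⟩
  have hjx := hx j hj
  rw [← map_smul, Submodule.mkQ_apply, Submodule.Quotient.mk_eq_zero] at hjx
  obtain ⟨m, hm⟩ := hjx
  rw [← hm, Subsingleton.elim m 0, map_zero]

theorem IsGVTorsion.torGV_eq_top {R : Type} [CommRing R] {T : Type} [AddCommGroup T]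
    [Module R T] (hT : IsGVTorsion R T) : torGV R T = ⊤ :=
  eq_top_iff.2 fun x _ => Submodule.subset_span (hT x)

theorem IsGVTorsion.isWProjective {R : Type} [CommRing R] {T : Type} [AddCommGroup T]
    [Module R T] (hT : IsGVTorsion R T) : IsWProjective R T := by
  intro N _ _ _ _ L _ _ ι h x
  have : Subsingleton (T ⧸ torGV R T) := Submodule.Quotient.subsingleton_iff.2 hT.torGV_eq_top
  have : Subsingleton L := h.subsingleton
  have : Subsingleton (extM R L N 1) := subsingleton_extM_of_projective R L N 0
  obtain ⟨J, hJ, -⟩ := hT 0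
  exact ⟨J, hJ, fun _ _ => Subsingleton.elim _ _⟩

/-- if `M` is GV-torsion-free and `(L, ι)` is a `w`-envelope of `M`,
then `L / ι(M)` is weak `w`-projective. -/
theorem weakWProjective_wEnvelope_quotient (R : Type) [CommRing R]
    (M L : Type) [AddCommGroup M] [Module R M] [AddCommGroup L] [Module R L]
    (ι : M →ₗ[R] L) (hM : IsGVTorsionFree R M) (h : IsWEnvelope R M L ι) :
    IsWeakWProjective R (L ⧸ LinearMap.range ι) :=
  fun N _ _ hN => hN.2 _ h.2.2.isWProjective 1 le_rfl
end
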